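/- Let ū be a super-solution and u̲ a sub-solution of (⋆) on (0,∞) such that: 0 ≤ ū, u̲ ≤ s_+ on (0,∞); ū(r) = ᾱ·r^{γ_+} + o(r^{γ_+}) and u̲(r) = α̲·r^{γ_+} + o(r^{γ_+}) as r → 0, with ᾱ > 0; ū(r) = s_+ − β̄·r^{−2} + o(r^{−2}) and u̲(r) = s_+ − β̲·r^{−2} + o(r^{−2}) as r → ∞, with β̲ > 0; and β̲ ≥ β̄. Then ᾱ ≥ α̲. -/

import Mathlib

open Set Filter Topology MeasureTheory
open scoped ENNReal NNReal

/-- `γ₊ = ((1-p) + √((p-1)² + 4q))/2`, the positive root of `γ² + (p-1)γ - q = 0`. -/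
noncomputable def gammaPlus (p q : ℝ) : ℝ :=
  ((1 - p) + Real.sqrt ((p - 1) ^ 2 + 4 * q)) / 2

/-- Condition (condF) on the nonlinearity `F` (with `0 < sp` recorded separately). -/
def CondF (F : ℝ → ℝ) (sp : ℝ) : Prop :=
  ContDiff ℝ 1 F ∧ F 0 = 0 ∧ F sp = 0 ∧
    (∀ t ∈ Set.Ioo 0 sp, F t < 0) ∧ (∀ t, sp < t → 0 < F t) ∧ 0 < deriv F sp

/-- The ODE (⋆) `u'' + (p/r) u' - (q/r²) u = F(u)` holds at the point `r`. -/
def ODEAt (p q : ℝ) (F : ℝ → ℝ) (u : ℝ → ℝ) (r : ℝ) : Prop :=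
  deriv (deriv u) r + (p / r) * deriv u r - (q / r ^ 2) * u r = F (u r)

/-- `ψ` is locally Lipschitz on the set `I`. -/
def LocLipOn (I : Set ℝ) (ψ : ℝ → ℝ) : Prop :=
  ∀ x ∈ I, ∃ K : ℝ≥0, ∃ t ∈ nhdsWithin x I, LipschitzOnWith K ψ t

/-- `ψ` is a locally Lipschitz, piecewise `C²` super-solution of (⋆) on `I`:
outside a locally finite set `S` of jump points it is `C²` and satisfies
`ψ'' + (p/r)ψ' - (q/r²)ψ ≤ F(ψ)`, and at each jump point the one-sided
derivatives exist with `ψ'(r₀⁻) > ψ'(r₀⁺)`. -/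
def IsSuperSolutionOn (p q : ℝ) (F : ℝ → ℝ) (I : Set ℝ) (ψ : ℝ → ℝ) : Prop :=
  LocLipOn I ψ ∧
    ∃ S : Set ℝ,
      (∀ x ∈ I, ∃ ε > 0, (S ∩ Set.Ioo (x - ε) (x + ε)).Finite) ∧
      (∀ x ∈ I \ S, ContDiffAt ℝ 2 ψ x ∧
        deriv (deriv ψ) x + (p / x) * deriv ψ x - (q / x ^ 2) * ψ x ≤ F (ψ x)) ∧
      (∀ x ∈ I ∩ S, ∃ dl dr : ℝ, HasDerivWithinAt ψ dl (Set.Iio x) x ∧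
        HasDerivWithinAt ψ dr (Set.Ioi x) x ∧ dr < dl)

/-- `ψ` is a locally Lipschitz, piecewise `C²` sub-solution of (⋆) on `I`. -/
def IsSubSolutionOn (p q : ℝ) (F : ℝ → ℝ) (I : Set ℝ) (ψ : ℝ → ℝ) : Prop :=
  LocLipOn I ψ ∧
    ∃ S : Set ℝ,
      (∀ x ∈ I, ∃ ε > 0, (S ∩ Set.Ioo (x - ε) (x + ε)).Finite) ∧
      (∀ x ∈ I \ S, ContDiffAt ℝ 2 ψ x ∧
        F (ψ x) ≤ deriv (deriv ψ) x + (p / x) * deriv ψ x - (q / x ^ 2) * ψ x) ∧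
      (∀ x ∈ I ∩ S, ∃ dl dr : ℝ, HasDerivWithinAt ψ dl (Set.Iio x) x ∧
        HasDerivWithinAt ψ dr (Set.Ioi x) x ∧ dl < dr)

/-- `u(r) = α·r^γ + o(r^γ)` as `r → 0⁺`. -/
def AsympZero (u : ℝ → ℝ) (α γ : ℝ) : Prop :=
  Filter.Tendsto (fun r : ℝ => (u r - α * r ^ γ) / r ^ γ) (nhdsWithin 0 (Set.Ioi 0)) (nhds 0)

/-- `u(r) = sp - β·r⁻² + o(r⁻²)` as `r → ∞`. -/
def AsympInfty (u : ℝ → ℝ) (sp β : ℝ) : Prop :=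
  Filter.Tendsto (fun r : ℝ => (u r - (sp - β / r ^ 2)) * r ^ 2) Filter.atTop (nhds 0)


/-- At the point `x`, the function `w` is either twice differentiable with
`w'' + (p/x) w' - (q/x²) w ≤ G`, or has a strictly concave corner. -/
def SupersolutionAt (p q : ℝ) (w : ℝ → ℝ) (G x : ℝ) : Prop :=
  (∃ (w' : ℝ → ℝ) (w₂ : ℝ), (∀ᶠ y in 𝓝 x, HasDerivAt w (w' y) y) ∧ HasDerivAt w' w₂ x ∧
      w₂ + p / x * w' x - q / x ^ 2 * w x ≤ G) ∨
    ∃ dl dr : ℝ, HasDerivWithinAt w dl (Iio x) x ∧ HasDerivWithinAt w dr (Ioi x) x ∧ dr < dl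

lemma ContDiffAt.eventually_hasDerivAt_deriv {f : ℝ → ℝ} {x : ℝ} (hf : ContDiffAt ℝ 2 f x) :
    (∀ᶠ y in 𝓝 x, HasDerivAt f (deriv f y) y) ∧ HasDerivAt (deriv f) (deriv (deriv f) x) x := by
  constructor
  · filter_upwards [hf.eventually (by simp)] with y hy
    exact (hy.differentiableAt (by norm_num)).hasDerivAt
  · have h1 : ContDiffAt ℝ 1 (deriv f) x := hf.derivWithin (by norm_num)
    exact (h1.differentiableAt (by norm_num)).hasDerivAt

lemma IsSuperSolutionOn.supersolutionAt {p q : ℝ} {F u : ℝ → ℝ} {I : Set ℝ}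
    (h : IsSuperSolutionOn p q F I u) {x : ℝ} (hx : x ∈ I) :
    SupersolutionAt p q u (F (u x)) x := by
  obtain ⟨-, S, -, h1, h2⟩ := h
  by_cases hS : x ∈ S
  · exact Or.inr (h2 x ⟨hx, hS⟩)
  · obtain ⟨hc, hi⟩ := h1 x ⟨hx, hS⟩
    obtain ⟨a, b⟩ := hc.eventually_hasDerivAt_deriv
    exact Or.inl ⟨_, _, a, b, hi⟩

lemma IsSubSolutionOn.supersolutionAt_neg {p q : ℝ} {F u : ℝ → ℝ} {I : Set ℝ}
    (h : IsSubSolutionOn p q F I u) {x : ℝ} (hx : x ∈ I) :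
    SupersolutionAt p q (fun y => -u y) (-F (u x)) x := by
  obtain ⟨-, S, -, h1, h2⟩ := h
  by_cases hS : x ∈ S
  · obtain ⟨dl, dr, hl, hr, hlt⟩ := h2 x ⟨hx, hS⟩
    exact Or.inr ⟨-dl, -dr, hl.fun_neg, hr.fun_neg, neg_lt_neg hlt⟩
  · obtain ⟨hc, hi⟩ := h1 x ⟨hx, hS⟩
    obtain ⟨a, b⟩ := hc.eventually_hasDerivAt_deriv
    exact Or.inl ⟨fun y => -deriv u y, _, a.mono fun y hy => hy.fun_neg, b.fun_neg, by linarith⟩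

namespace SupersolutionAt

variable {p q G G₁ G₂ x : ℝ} {w u v : ℝ → ℝ}

lemma mono (h : SupersolutionAt p q w G₁ x) (hG : G₁ ≤ G₂) : SupersolutionAt p q w G₂ x := by
  rcases h with ⟨w', w₂, h1, h2, h3⟩ | h
  · exact Or.inl ⟨w', w₂, h1, h2, h3.trans hG⟩
  · exact Or.inr h

lemma exists_hasDerivWithinAt (h : SupersolutionAt p q w G x) :
    ∃ dl dr : ℝ, HasDerivWithinAt w dl (Iio x) x ∧ HasDerivWithinAt w dr (Ioi x) x ∧ dr ≤ dl := by
  rcases h with ⟨w', w₂, h1, h2, h3⟩ | ⟨dl, dr, hl, hr, hlt⟩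
  · have := h1.self_of_nhds
    exact ⟨_, _, this.hasDerivWithinAt, this.hasDerivWithinAt, le_rfl⟩
  · exact ⟨dl, dr, hl, hr, hlt.le⟩

lemma add (hu : SupersolutionAt p q u G₁ x) (hv : SupersolutionAt p q v G₂ x) :
    SupersolutionAt p q (fun y => u y + v y) (G₁ + G₂) x := by
  obtain ⟨al, ar, hal, har, ha⟩ := hu.exists_hasDerivWithinAt
  obtain ⟨bl, br, hbl, hbr, hb⟩ := hv.exists_hasDerivWithinAt
  rcases hu with ⟨u', u₂, h1, h2, h3⟩ | ⟨dl, dr, hl, hr, hlt⟩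
  · rcases hv with ⟨v', v₂, k1, k2, k3⟩ | ⟨dl, dr, hl, hr, hlt⟩
    · refine Or.inl ⟨fun y => u' y + v' y, u₂ + v₂, ?_, h2.fun_add k2, by linarith⟩
      filter_upwards [h1, k1] with y hy ky using hy.fun_add ky
    · exact Or.inr ⟨_, _, hal.fun_add hl, har.fun_add hr, by linarith⟩
  · exact Or.inr ⟨_, _, hl.fun_add hbl, hr.fun_add hbr, by linarith⟩

lemma comp_mul_left {R : ℝ} (hR : 0 < R) (h : SupersolutionAt p q u G (R * x)) :
    SupersolutionAt p q (fun y => u (R * y)) (R ^ 2 * G) x := by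
  have hd : ∀ y, HasDerivAt (fun y => R * y) R y := fun y => by
    simpa using (hasDerivAt_id y).const_mul R
  rcases h with ⟨u', u₂, h1, h2, h3⟩ | ⟨dl, dr, hl, hr, hlt⟩
  · refine Or.inl ⟨fun y => u' (R * y) * R, u₂ * R * R, ?_, ?_, ?_⟩
    · have hc : Tendsto (fun y => R * y) (𝓝 x) (𝓝 (R * x)) := (hd x).continuousAt.tendsto
      filter_upwards [hc.eventually h1] with y hy using HasDerivAt.comp y hy (hd y)
    · exact (HasDerivAt.comp x h2 (hd x)).mul_const R
    · have := mul_le_mul_of_nonneg_left h3 (sq_nonneg R)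
      refine le_trans (le_of_eq ?_) this
      rcases eq_or_ne x 0 with rfl | hx
      · simp; ring
      · field_simp
  · refine Or.inr ⟨dl * R, dr * R, ?_, ?_, by gcongr⟩
    · exact HasDerivWithinAt.comp x hl (hd x).hasDerivWithinAt
        fun y hy => mul_lt_mul_of_pos_left hy hR
    · exact HasDerivWithinAt.comp x hr (hd x).hasDerivWithinAt
        fun y hy => mul_lt_mul_of_pos_left hy hR

end SupersolutionAt

lemma IsLocalMin.second_derivative_nonneg {f f' : ℝ → ℝ} {f₂ x : ℝ} (hf : IsLocalMin f x)
    (h1 : ∀ᶠ y in 𝓝 x, HasDerivAt f (f' y) y) (h2 : HasDerivAt f' f₂ x) : 0 ≤ f₂ := by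
  by_contra! hlt
  have e1 : deriv f =ᶠ[𝓝 x] f' := h1.mono fun y hy => hy.deriv
  have e2 : deriv (deriv f) x = f₂ := by rw [e1.deriv_eq, h2.deriv]
  have hmax : IsLocalMax f x :=
    isLocalMax_of_deriv_deriv_neg (by rwa [e2]) hf.deriv_eq_zero h1.self_of_nhds.continuousAt
  have hc : f =ᶠ[𝓝 x] fun _ => f x := by
    filter_upwards [hf, hmax] with y a b using le_antisymm b a
  have e3 : deriv f =ᶠ[𝓝 x] fun _ => 0 := by simpa using hc.deriv
  have := e3.deriv_eq
  simp [e2] at this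
  linarith

lemma IsLocalMin.le_of_hasDerivWithinAt {f : ℝ → ℝ} {dl dr x : ℝ} (hf : IsLocalMin f x)
    (hl : HasDerivWithinAt f dl (Iio x) x) (hr : HasDerivWithinAt f dr (Ioi x) x) : dl ≤ dr := by
  have h1 : dl ≤ 0 := by
    rw [hasDerivWithinAt_iff_tendsto_slope' (by simp)] at hl
    refine le_of_tendsto hl ?_
    filter_upwards [self_mem_nhdsWithin, nhdsWithin_le_nhds hf] with y hy hm
    rw [slope_def_field]
    exact div_nonpos_of_nonneg_of_nonpos (sub_nonneg.2 hm) (sub_nonpos.2 (le_of_lt hy))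
  have h2 : 0 ≤ dr := by
    rw [hasDerivWithinAt_iff_tendsto_slope' (by simp)] at hr
    refine ge_of_tendsto hr ?_
    filter_upwards [self_mem_nhdsWithin, nhdsWithin_le_nhds hf] with y hy hm
    rw [slope_def_field]
    exact div_nonneg (sub_nonneg.2 hm) (sub_nonneg.2 (le_of_lt hy))
  linarith

/-- A supersolution satisfies the differential inequality in the viscosity sense. -/
lemma SupersolutionAt.le_of_isLocalMin {p q G x φ₂ : ℝ} {w φ φ' : ℝ → ℝ}
    (hw : SupersolutionAt p q w G x) (h1 : ∀ᶠ y in 𝓝 x, HasDerivAt φ (φ' y) y)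
    (h2 : HasDerivAt φ' φ₂ x) (hmin : IsLocalMin (fun y => w y - φ y) x) :
    φ₂ + p / x * φ' x - q / x ^ 2 * w x ≤ G := by
  rcases hw with ⟨w', w₂, k1, k2, k3⟩ | ⟨dl, dr, hl, hr, hlt⟩
  · have a : ∀ᶠ y in 𝓝 x, HasDerivAt (fun y => w y - φ y) (w' y - φ' y) y := by
      filter_upwards [h1, k1] with y hy ky using ky.fun_sub hy
    have b := hmin.second_derivative_nonneg a (k2.fun_sub h2)
    have c := hmin.hasDerivAt_eq_zero a.self_of_nhds
    rw [← sub_eq_zero.1 c]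
    linarith
  · have := hmin.le_of_hasDerivWithinAt (hl.fun_sub h1.self_of_nhds.hasDerivWithinAt)
      (hr.fun_sub h1.self_of_nhds.hasDerivWithinAt)
    linarith

/-- Comparison of a supersolution with a strict smooth subsolution. -/
lemma lt_of_supersolutionAt {p q a b : ℝ} {w φ φ' φ₂ G : ℝ → ℝ} (hab : a ≤ b)
    (hc : ContinuousOn w (Icc a b)) (hw : ∀ x ∈ Ioo a b, SupersolutionAt p q w (G x) x)
    (hcφ : ContinuousOn φ (Icc a b))
    (h1 : ∀ x ∈ Ioo a b, HasDerivAt φ (φ' x) x) (h2 : ∀ x ∈ Ioo a b, HasDerivAt φ' (φ₂ x) x)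
    (ha : φ a < w a) (hb : φ b < w b)
    (hφ : ∀ x ∈ Ioo a b, w x ≤ φ x → G x < φ₂ x + p / x * φ' x - q / x ^ 2 * w x) :
    ∀ x ∈ Icc a b, φ x < w x := by
  obtain ⟨y, hy, hmin⟩ := isCompact_Icc.exists_isMinOn (nonempty_Icc.2 hab) (hc.sub hcφ)
  have key : 0 < w y - φ y := by
    by_contra! hle
    have hya : a ≠ y := by rintro rfl; linarith
    have hyb : y ≠ b := by rintro rfl; linarith
    have hyI : y ∈ Ioo a b := ⟨lt_of_le_of_ne hy.1 hya, lt_of_le_of_ne hy.2 hyb⟩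
    have hloc : IsLocalMin (fun y => w y - φ y) y := hmin.isLocalMin (Icc_mem_nhds hyI.1 hyI.2)
    have hev : ∀ᶠ z in 𝓝 y, HasDerivAt φ (φ' z) z := by
      filter_upwards [Ioo_mem_nhds hyI.1 hyI.2] with z hz using h1 z hz
    have := (hw y hyI).le_of_isLocalMin hev (h2 y hyI) hloc
    linarith [hφ y hyI (by linarith)]
  intro x hx
  have : w y - φ y ≤ w x - φ x := hmin hx
  linarith

lemma gammaPlus_pos (p : ℝ) {q : ℝ} (hq : 0 < q) : 0 < gammaPlus p q := by
  have : p - 1 < √((p - 1) ^ 2 + 4 * q) := Real.lt_sqrt_of_sq_lt (by linarith)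
  unfold gammaPlus
  linarith

lemma gammaPlus_sq (p : ℝ) {q : ℝ} (hq : 0 < q) :
    gammaPlus p q ^ 2 + (p - 1) * gammaPlus p q = q := by
  have := Real.sq_sqrt (show 0 ≤ (p - 1) ^ 2 + 4 * q by positivity)
  unfold gammaPlus
  linear_combination this / 4

lemma hasDerivAt_rpow_mul_exp (γ A : ℝ) {x : ℝ} (hx : 0 < x) :
    HasDerivAt (fun y => y ^ γ * Real.exp (A * y)) (x ^ γ * Real.exp (A * x) * (γ / x + A)) x := by
  have h1 := Real.hasDerivAt_rpow_const (x := x) (p := γ) (Or.inl hx.ne')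
  have h2 : HasDerivAt (fun y => Real.exp (A * y)) (Real.exp (A * x) * A) x := by
    simpa using ((hasDerivAt_id x).const_mul A).exp
  refine (h1.fun_mul h2).congr_deriv ?_
  rw [Real.rpow_sub_one hx.ne']
  field_simp

/-- A Hopf-type lower bound for nonnegative supersolutions at the singular point `0`. -/
lemma exists_mul_rpow_le_of_supersolutionAt {p q C b : ℝ} {w : ℝ → ℝ} (hp : 0 ≤ p) (hq : 0 < q)
    (hC : 0 ≤ C) (hb : 0 < b) (hc : ContinuousOn w (Ioi 0)) (hw0 : ∀ x, 0 < x → 0 ≤ w x)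
    (hw : ∀ x, 0 < x → SupersolutionAt p q w (C * w x) x) (hwb : 0 < w b) :
    ∃ ε > 0, ∀ x ∈ Ioc 0 b, ε * x ^ gammaPlus p q ≤ w x := by
  have hγ := gammaPlus_pos p hq
  have hγq := gammaPlus_sq p hq
  set γ := gammaPlus p q
  set A := C + 1 with hA
  set f : ℝ → ℝ := fun y => y ^ γ * Real.exp (A * y) with hf
  have hfpos : ∀ y, 0 < y → 0 < f y := fun y hy => by positivity
  have hfd : ∀ y, 0 < y → HasDerivAt f (f y * (γ / y + A)) y := fun y hy =>
    hasDerivAt_rpow_mul_exp γ A hy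
  have hfd2 : ∀ y, 0 < y → HasDerivAt (fun y => f y * (γ / y + A))
      (f y * ((γ / y + A) ^ 2 - γ / y ^ 2)) y := by
    intro y hy
    have h1 : HasDerivAt (fun y => γ / y + A) (-γ / y ^ 2) y := by
      have := ((hasDerivAt_inv hy.ne').const_mul γ).add_const A
      refine this.congr_deriv ?_
      field_simp
    refine ((hfd y hy).fun_mul h1).congr_deriv ?_
    ring
  have hLf : ∀ y, 0 < y → C * f y < f y * ((γ / y + A) ^ 2 - γ / y ^ 2)
      + p / y * (f y * (γ / y + A)) - q / y ^ 2 * f y := by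
    intro y hy
    have e : f y * ((γ / y + A) ^ 2 - γ / y ^ 2) + p / y * (f y * (γ / y + A)) - q / y ^ 2 * f y
        = f y * (A ^ 2 + (2 * γ + p) * A / y) := by
      rw [← hγq]; field_simp; ring
    rw [e, mul_comm C]
    have h3 : 0 ≤ (2 * γ + p) * A / y := by positivity
    apply mul_lt_mul_of_pos_left _ (hfpos y hy)
    nlinarith
  obtain ⟨ε, hε, hεb⟩ : ∃ ε > 0, ε * f b < w b :=
    ⟨w b / (2 * f b), div_pos hwb (by linarith [hfpos b hb]), by
      have := hfpos b hb
      field_simp; linarith⟩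
  refine ⟨ε, hε, fun x hx => ?_⟩
  have main : ∀ δ > 0, ε * f x - δ ≤ w x := by
    intro δ hδ
    have hlim : Tendsto (fun y => ε * f y) (𝓝[>] 0) (𝓝 0) := by
      have h1 : ContinuousAt (fun y => ε * f y) 0 :=
        ((Real.continuousAt_rpow_const 0 γ (Or.inr hγ.le)).mul (by fun_prop)).const_mul ε
      have h2 : ε * f 0 = 0 := by simp [hf, Real.zero_rpow hγ.ne']
      have := h1.tendsto
      rw [h2] at this
      exact this.mono_left nhdsWithin_le_nhds
    have hsmall : ∀ᶠ y in 𝓝[>] (0 : ℝ), y ∈ Ioo 0 x := Ioo_mem_nhdsGT hx.1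
    obtain ⟨a, ⟨ha0, hax⟩, hae⟩ := 
      (hsmall.and (hlim.eventually (gt_mem_nhds hδ))).exists
    refine (lt_of_supersolutionAt (a := a) (b := b) (p := p) (q := q) (w := w)
      (G := fun x => C * w x) (φ := fun y => ε * f y - δ)
      (φ' := fun y => ε * (f y * (γ / y + A)))
      (φ₂ := fun y => ε * (f y * ((γ / y + A) ^ 2 - γ / y ^ 2)))
      (hax.le.trans hx.2) (hc.mono fun y hy => ha0.trans_le hy.1)
      (fun y hy => hw y (ha0.trans hy.1)) ?_ ?_ ?_ ?_ ?_ ?_ x ⟨hax.le, hx.2⟩).le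
    · intro y hy
      exact (((hfd y (ha0.trans_le hy.1)).const_mul ε).sub_const
        δ).continuousAt.continuousWithinAt
    · intro y hy
      exact ((hfd y (ha0.trans hy.1)).const_mul ε).sub_const δ
    · intro y hy
      exact (hfd2 y (ha0.trans hy.1)).const_mul ε
    · linarith [hw0 a ha0]
    · linarith
    · intro y hy hle
      have hy0 : 0 < y := ha0.trans hy.1
      have h1 := mul_lt_mul_of_pos_left (hLf y hy0) hε
      have h2 : q / y ^ 2 * w y ≤ q / y ^ 2 * (ε * f y) :=
        mul_le_mul_of_nonneg_left (by linarith) (by positivity)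
      have h3 : C * w y ≤ C * (ε * f y) := mul_le_mul_of_nonneg_left (by linarith) hC
      linarith
  have h1 : ε * f x ≤ w x := le_of_forall_pos_le_add fun δ hδ => by linarith [main δ hδ]
  refine le_trans ?_ h1
  have : 1 ≤ Real.exp (A * x) := Real.one_le_exp (by have := hx.1; positivity)
  have h5 : 0 ≤ x ^ γ := Real.rpow_nonneg hx.1.le _
  exact mul_le_mul_of_nonneg_left (le_mul_of_one_le_right h5 this) hε.le

lemma LocLipOn.continuousOn {I : Set ℝ} {u : ℝ → ℝ} (h : LocLipOn I u) : ContinuousOn u I := by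
  intro x hx
  obtain ⟨K, t, ht, hK⟩ := h x hx
  exact (hK.continuousOn x (mem_of_mem_nhdsWithin hx ht)).mono_of_mem_nhdsWithin ht

lemma AsympZero.tendsto_div {u : ℝ → ℝ} {α γ : ℝ} (h : AsympZero u α γ) :
    Tendsto (fun r => u r / r ^ γ) (𝓝[>] 0) (𝓝 α) := by
  have h1 := h.add_const α
  rw [zero_add] at h1
  refine h1.congr' ?_
  filter_upwards [self_mem_nhdsWithin] with r hr
  have : 0 < r ^ γ := Real.rpow_pos_of_pos hr γ
  field_simp
  ring

lemma AsympInfty.tendsto_mul {u : ℝ → ℝ} {s β : ℝ} (h : AsympInfty u s β) :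
    Tendsto (fun r => (s - u r) * r ^ 2) atTop (𝓝 β) := by
  have h1 := h.const_sub β
  rw [sub_zero] at h1
  refine h1.congr' ?_
  filter_upwards [eventually_gt_atTop 0] with r hr
  field_simp
  ring

lemma tendsto_of_tendsto_mul_sq {u : ℝ → ℝ} {s β : ℝ}
    (h : Tendsto (fun r => (s - u r) * r ^ 2) atTop (𝓝 β)) : Tendsto u atTop (𝓝 s) := by
  have h1 := (h.div_atTop (tendsto_pow_atTop two_ne_zero)).const_sub s
  rw [sub_zero] at h1
  refine h1.congr' ?_
  filter_upwards [eventually_gt_atTop 0] with r hr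
  field_simp
  ring

lemma ContDiff.exists_sub_le_mul_sub {F : ℝ → ℝ} (hF : ContDiff ℝ 1 F) (a b : ℝ) :
    ∃ C, 0 ≤ C ∧ ∀ x ∈ Icc a b, ∀ y ∈ Icc a b, x ≤ y → F y - F x ≤ C * (y - x) := by
  obtain ⟨C, hC⟩ := isCompact_Icc.exists_bound_of_continuousOn
    (hF.continuous_deriv_one.continuousOn (s := Icc a b))
  refine ⟨max C 0, le_max_right _ _, fun x hx y hy hxy => ?_⟩
  refine (convex_Icc a b).image_sub_le_mul_sub_of_deriv_le hF.continuous.continuousOn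
    (hF.differentiable one_ne_zero).differentiableOn (fun z hz => ?_) x hx y hy hxy
  exact (le_abs_self _).trans ((hC z (interior_subset hz)).trans (le_max_left _ _))

lemma eventually_nhdsGT_zero_iff {P : ℝ → Prop} :
    (∀ᶠ r in 𝓝[>] 0, P r) ↔ ∃ δ > 0, ∀ r, 0 < r → r < δ → P r := by
  constructor
  · intro h
    obtain ⟨δ, hδ, hs⟩ := mem_nhdsGT_iff_exists_Ioo_subset.1 h
    exact ⟨δ, hδ, fun r h0 h1 => hs ⟨h0, h1⟩⟩
  · rintro ⟨δ, hδ, hs⟩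
    exact mem_nhdsGT_iff_exists_Ioo_subset.2 ⟨δ, hδ, fun r hr => hs r hr.1 hr.2⟩

/-- Some dilation of `u` lies above `v`. -/
lemma exists_le_comp_mul {u v : ℝ → ℝ} {s γ α β β' ε m b : ℝ} (hs : 0 < s) (hγ : 0 < γ)
    (hvc : ContinuousOn v (Ioi 0)) (hu0 : ∀ r, 0 < r → 0 ≤ u r) (hvs : ∀ r, 0 < r → v r < s)
    (hε : 0 < ε) (hm : 0 < m) (hub : ∀ r ∈ Ioc 0 b, ε * r ^ γ ≤ u r) (hum : ∀ r, b < r → m ≤ u r)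
    (hv0 : Tendsto (fun r => v r / r ^ γ) (𝓝[>] 0) (𝓝 α))
    (hui : Tendsto (fun r => (s - u r) * r ^ 2) atTop (𝓝 β))
    (hvi : Tendsto (fun r => (s - v r) * r ^ 2) atTop (𝓝 β')) (hβ' : 0 < β') :
    ∃ R, 1 ≤ R ∧ ∀ r, 0 < r → v r ≤ u (R * r) := by
  obtain ⟨K, hK⟩ := exists_gt α
  have hKlim : Tendsto (fun r : ℝ => K * r ^ γ) (𝓝[>] 0) (𝓝 0) := by
    have h := ((Real.continuousAt_rpow_const 0 γ (Or.inr hγ.le)).const_mul K).tendsto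
    rw [Real.zero_rpow hγ.ne', mul_zero] at h
    exact h.mono_left nhdsWithin_le_nhds
  obtain ⟨δ, hδ, hδv⟩ := eventually_nhdsGT_zero_iff.1
    ((hv0.eventually (gt_mem_nhds hK)).and (hKlim.eventually (gt_mem_nhds hm)))
  obtain ⟨L, hL⟩ : ∃ L, ∀ r, 0 < r → (s - u r) * r ^ 2 ≤ L := by
    obtain ⟨M, hM⟩ := eventually_atTop.1 (hui.eventually (gt_mem_nhds (lt_add_one β)))
    refine ⟨max (β + 1) (s * M ^ 2), fun r hr => ?_⟩
    rcases le_total M r with h | h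
    · exact (hM r h).le.trans (le_max_left _ _)
    · refine le_trans ?_ (le_max_right _ _)
      have := hu0 r hr
      gcongr
      linarith
  obtain ⟨c, hc, hcv⟩ : ∃ c > 0, ∀ r, δ ≤ r → c ≤ (s - v r) * r ^ 2 := by
    obtain ⟨N, hN⟩ := eventually_atTop.1 (hvi.eventually (lt_mem_nhds (half_lt_self hβ')))
    have hcont : ContinuousOn (fun r => (s - v r) * r ^ 2) (Icc δ (max N δ)) :=
      ((continuousOn_const.sub hvc).mul (by fun_prop)).mono fun r hr => hδ.trans_le hr.1
    obtain ⟨y, hy, hmin⟩ := isCompact_Icc.exists_isMinOn (nonempty_Icc.2 (le_max_right N δ)) hcont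
    have hy0 : 0 < y := hδ.trans_le hy.1
    refine ⟨min (β' / 2) ((s - v y) * y ^ 2), lt_min (by linarith)
      (mul_pos (sub_pos.2 (hvs y hy0)) (by positivity)), fun r hr => ?_⟩
    rcases le_total N r with h | h
    · exact (min_le_left _ _).trans (hN r h).le
    · exact (min_le_right _ _).trans (hmin ⟨hr, h.trans (le_max_left _ _)⟩)
  have e1 : ∀ᶠ R : ℝ in atTop, K ≤ ε * R ^ γ :=
    ((tendsto_rpow_atTop hγ).const_mul_atTop hε).eventually_ge_atTop K
  have e2 : ∀ᶠ R : ℝ in atTop, L ≤ c * R ^ 2 :=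
    ((tendsto_pow_atTop two_ne_zero).const_mul_atTop hc).eventually_ge_atTop L
  obtain ⟨R, hR1, hR2, hR3⟩ := ((eventually_ge_atTop 1).and (e1.and e2)).exists
  have hR0 : 0 < R := by linarith
  refine ⟨R, hR1, fun r hr => ?_⟩
  rcases lt_or_ge r δ with h | h
  · obtain ⟨h1, h2⟩ := hδv r hr h
    have hrγ : 0 < r ^ γ := Real.rpow_pos_of_pos hr γ
    have h3 : v r < K * r ^ γ := (div_lt_iff₀ hrγ).1 h1
    rcases le_or_gt (R * r) b with hb | hb
    · have h4 := hub (R * r) ⟨by positivity, hb⟩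
      rw [Real.mul_rpow hR0.le hr.le] at h4
      have := mul_le_mul_of_nonneg_right hR2 hrγ.le
      linarith
    · linarith [hum _ hb]
  · have h1 := hL (R * r) (by positivity)
    have h2 := mul_le_mul_of_nonneg_right (hcv r h) (sq_nonneg R)
    have h3 : (s - u (R * r)) * (R * r) ^ 2 ≤ (s - v r) * (R * r) ^ 2 := by
      rw [mul_pow] at h1 ⊢
      linarith
    have := le_of_mul_le_mul_right h3 (by positivity)
    linarith

/-- Strict ordering, including at `0` and `∞`, persists under small changes of the dilation. -/
lemma eventually_le_comp_mul {u v : ℝ → ℝ} {s γ α α' β β' R₀ : ℝ} (hR₀ : 1 < R₀)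
    (huc : ContinuousOn u (Ioi 0)) (hvc : ContinuousOn v (Ioi 0))
    (hu0 : Tendsto (fun r => u r / r ^ γ) (𝓝[>] 0) (𝓝 α))
    (hv0 : Tendsto (fun r => v r / r ^ γ) (𝓝[>] 0) (𝓝 α'))
    (hui : Tendsto (fun r => (s - u r) * r ^ 2) atTop (𝓝 β))
    (hvi : Tendsto (fun r => (s - v r) * r ^ 2) atTop (𝓝 β'))
    (hα : α' < α * R₀ ^ γ) (hβ : β < β' * R₀ ^ 2) (hlt : ∀ r, 0 < r → v r < u (R₀ * r)) :
    ∀ᶠ R in 𝓝 R₀, ∀ r, 0 < r → v r ≤ u (R * r) := by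
  have hR₀0 : 0 < R₀ := by linarith
  have hRγ : 0 < R₀ ^ γ := Real.rpow_pos_of_pos hR₀0 γ
  have hRsq : 0 < R₀ ^ 2 := by positivity
  obtain ⟨c₁, hc₁, hc₁'⟩ := exists_between hα
  obtain ⟨c₂, hc₂, hc₂'⟩ := exists_between ((div_lt_iff₀ hRγ).2 hc₁')
  rw [div_lt_iff₀ hRγ] at hc₂
  obtain ⟨d₁, hd₁, hd₁'⟩ := exists_between ((div_lt_iff₀ hRsq).2 hβ)
  rw [div_lt_iff₀ hRsq] at hd₁
  obtain ⟨d₂, hd₂, hd₂'⟩ := exists_between hd₁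
  obtain ⟨δ, hδ, hδP⟩ := eventually_nhdsGT_zero_iff.1
    ((hu0.eventually (lt_mem_nhds hc₂')).and (hv0.eventually (gt_mem_nhds hc₁)))
  obtain ⟨M, hM⟩ := eventually_atTop.1
    ((hui.eventually (gt_mem_nhds hd₂)).and (hvi.eventually (lt_mem_nhds hd₁')))
  have hη : 0 < δ / (2 * R₀) := by positivity
  have hmid : ∀ᶠ R in 𝓝 R₀, ∀ r ∈ Icc (δ / (2 * R₀)) M, v r ≤ u (R * r) := by
    refine isCompact_Icc.eventually_forall_of_forall_eventually fun y hy => ?_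
    have hy0 : 0 < y := hη.trans_le hy.1
    have h1 : ContinuousAt (fun z : ℝ × ℝ => u (z.1 * z.2)) (R₀, y) :=
      ContinuousAt.comp (f := fun z : ℝ × ℝ => z.1 * z.2) (g := u)
        (huc.continuousAt (Ioi_mem_nhds (mul_pos hR₀0 hy0))) (by fun_prop)
    have h2 : ContinuousAt (fun z : ℝ × ℝ => v z.2) (R₀, y) :=
      ContinuousAt.comp (f := fun z : ℝ × ℝ => z.2) (g := v)
        (hvc.continuousAt (Ioi_mem_nhds hy0)) (by fun_prop)
    exact (h2.eventually_lt h1 (hlt y hy0)).mono fun z hz => hz.le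
  have e1 : ∀ᶠ R in 𝓝 R₀, c₁ < c₂ * R ^ γ :=
    ((Real.continuousAt_rpow_const R₀ γ (Or.inl hR₀0.ne')).const_mul c₂).eventually
      (lt_mem_nhds hc₂)
  have e2 : ∀ᶠ R in 𝓝 R₀, d₂ < d₁ * R ^ 2 := by
    have : ContinuousAt (fun R : ℝ => d₁ * R ^ 2) R₀ := by fun_prop
    exact this.eventually (lt_mem_nhds hd₂')
  filter_upwards [hmid, e1, e2, lt_mem_nhds hR₀, gt_mem_nhds (show R₀ < 2 * R₀ by linarith)]
    with R h1 h2 h3 h4 h5 r hr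
  have hR0 : 0 < R := by linarith
  rcases lt_or_ge r (δ / (2 * R₀)) with hrη | hrη
  · rw [lt_div_iff₀ (by positivity)] at hrη
    have hRr : R * r < δ := by nlinarith
    have hrγ : 0 < r ^ γ := Real.rpow_pos_of_pos hr γ
    have a1 := (hδP (R * r) (by positivity) hRr).1
    have a2 := (hδP r hr (by nlinarith)).2
    rw [lt_div_iff₀ (by positivity), Real.mul_rpow hR0.le hr.le] at a1
    rw [div_lt_iff₀ hrγ] at a2
    have := mul_lt_mul_of_pos_right h2 hrγ
    linarith
  · rcases le_or_gt r M with hrM | hrM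
    · exact h1 r ⟨hrη, hrM⟩
    · have a1 := (hM (R * r) (by nlinarith)).1
      have a2 := mul_lt_mul_of_pos_right (hM r hrM.le).2 (show 0 < R ^ 2 by positivity)
      have a3 : (s - u (R * r)) * (R * r) ^ 2 < (s - v r) * (R * r) ^ 2 := by
        rw [mul_pow] at a1 ⊢
        linarith
      have := lt_of_mul_lt_mul_right a3 (by positivity)
      linarith

lemma le_mul_rpow_of_le_comp_mul {u v : ℝ → ℝ} {γ α α' R b ε : ℝ} (hR : 0 < R) (hb : 0 < b)
    (hu0 : Tendsto (fun r => u r / r ^ γ) (𝓝[>] 0) (𝓝 α))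
    (hv0 : Tendsto (fun r => v r / r ^ γ) (𝓝[>] 0) (𝓝 α'))
    (h : ∀ r ∈ Ioc 0 b, v r + ε * r ^ γ ≤ u (R * r)) : α' + ε ≤ α * R ^ γ := by
  have hlim : Tendsto (fun r => R * r) (𝓝[>] 0) (𝓝[>] 0) := by
    refine tendsto_nhdsWithin_iff.2 ⟨?_, ?_⟩
    · have : Tendsto (fun r => R * r) (𝓝 0) (𝓝 (R * 0)) := tendsto_id.const_mul R
      rw [mul_zero] at this
      exact this.mono_left nhdsWithin_le_nhds
    · filter_upwards [self_mem_nhdsWithin] with r hr using mul_pos hR hr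
  refine le_of_tendsto_of_tendsto (hv0.add_const ε) ((hu0.comp hlim).mul_const (R ^ γ)) ?_
  filter_upwards [Ioc_mem_nhdsGT hb] with r hr
  have hrγ : 0 < r ^ γ := Real.rpow_pos_of_pos hr.1 γ
  have hRγ : 0 < R ^ γ := Real.rpow_pos_of_pos hR γ
  have := h r hr
  simp only [Function.comp_apply]
  rw [Real.mul_rpow hR.le hr.1.le, div_mul_eq_div_div_swap, div_mul_cancel₀ _ hRγ.ne',
    le_div_iff₀ hrγ, add_mul, div_mul_cancel₀ _ hrγ.ne']
  exact this

/-- under the comparison hypotheses with `β̲ ≥ β̄`, one has `ᾱ ≥ α̲`. -/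
theorem stmt4 (p q sp : ℝ) (hp : 0 ≤ p) (hq : 0 < q) (hsp : 0 < sp)
    (F : ℝ → ℝ) (hF : CondF F sp)
    (ub lb : ℝ → ℝ) (αb αl βb βl : ℝ)
    (hsuper : IsSuperSolutionOn p q F (Set.Ioi 0) ub)
    (hsub : IsSubSolutionOn p q F (Set.Ioi 0) lb)
    (hubnd : ∀ r ∈ Set.Ioi (0:ℝ), 0 ≤ ub r ∧ ub r ≤ sp)
    (hlbnd : ∀ r ∈ Set.Ioi (0:ℝ), 0 ≤ lb r ∧ lb r ≤ sp)
    (hαb : 0 < αb)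
    (h0ub : AsympZero ub αb (gammaPlus p q))
    (h0lb : AsympZero lb αl (gammaPlus p q))
    (hβl : 0 < βl)
    (hiub : AsympInfty ub sp βb)
    (hilb : AsympInfty lb sp βl)
    (hβ : βb ≤ βl) :
    αl ≤ αb := by
  have hγ := gammaPlus_pos p hq
  have huc := hsuper.1.continuousOn
  have hlc := hsub.1.continuousOn
  have hu0 := h0ub.tendsto_div
  have hl0 := h0lb.tendsto_div
  have hui := hiub.tendsto_mul
  have hli := hilb.tendsto_mul
  obtain ⟨hFd, -, hFsp, hFneg, -, -⟩ := hF
  have hF0 : ∀ t, 0 ≤ t → t ≤ sp → F t ≤ 0 := by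
    intro t h0 h1
    have h : Ioo 0 sp ⊆ {t | F t ≤ 0} := fun t ht => (hFneg t ht).le
    have hcl : IsClosed {t | F t ≤ 0} := isClosed_le hFd.continuous continuous_const
    have := closure_minimal h hcl
    rw [closure_Ioo hsp.ne] at this
    exact this ⟨h0, h1⟩
  have hlsp : ∀ r, 0 < r → lb r < sp := by
    intro r hr
    refine lt_of_le_of_ne (hlbnd r hr).2 fun heq => ?_
    have hmin : IsLocalMin (fun y => -lb y - 0) r := by
      filter_upwards [Ioi_mem_nhds hr] with y hy
      have := (hlbnd y hy).2
      linarith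
    have := (hsub.supersolutionAt_neg hr).le_of_isLocalMin (φ := fun _ => 0) (φ' := fun _ => 0)
      (Eventually.of_forall fun y => hasDerivAt_const y 0) (hasDerivAt_const r 0) hmin
    rw [heq, hFsp] at this
    have h2 : 0 < q / r ^ 2 * sp := by positivity
    linarith
  have hularge : ∀ᶠ r in atTop, sp / 2 < ub r :=
    (tendsto_of_tendsto_mul_sq hui).eventually (lt_mem_nhds (half_lt_self hsp))
  obtain ⟨b, hb⟩ := eventually_atTop.1 hularge
  have hb0 : 0 < max b 1 := by positivity
  obtain ⟨ε, hε, hεu⟩ := exists_mul_rpow_le_of_supersolutionAt hp hq le_rfl hb0 huc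
    (fun x hx => (hubnd x hx).1)
    (fun x hx => (hsuper.supersolutionAt hx).mono
      (by simpa using hF0 _ (hubnd x hx).1 (hubnd x hx).2))
    (by linarith [hb _ (le_max_left b 1)])
  by_contra! hα
  set A := {R : ℝ | 1 ≤ R ∧ ∀ r, 0 < r → lb r ≤ ub (R * r)}
  have hAne : A.Nonempty := exists_le_comp_mul hsp hγ hlc (fun r hr => (hubnd r hr).1) hlsp hε
    (half_pos hsp) hεu (fun r hr => (hb r ((le_max_left b 1).trans hr.le)).le) hl0 hui hli hβl
  have hAbdd : BddBelow A := ⟨1, fun R hR => hR.1⟩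
  set R₀ := sInf A
  have hR₀1 : 1 ≤ R₀ := le_csInf hAne fun R hR => hR.1
  have hR₀0 : 0 < R₀ := by linarith
  have hle : ∀ r, 0 < r → lb r ≤ ub (R₀ * r) := by
    intro r hr
    have : (𝓝[A] R₀).NeBot :=
      mem_closure_iff_nhdsWithin_neBot.1 (csInf_mem_closure hAne hAbdd)
    have hcont : ContinuousAt (fun R => ub (R * r)) R₀ :=
      ContinuousAt.comp (f := fun R => R * r) (g := ub)
        (huc.continuousAt (Ioi_mem_nhds (mul_pos hR₀0 hr))) (by fun_prop)
    refine ge_of_tendsto (hcont.tendsto.mono_left (nhdsWithin_le_nhds (s := A))) ?_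
    filter_upwards [self_mem_nhdsWithin] with R hR using hR.2 r hr
  have hR₀lt : 1 < R₀ := by
    refine lt_of_le_of_ne hR₀1 fun h => ?_
    have := le_mul_rpow_of_le_comp_mul (ε := 0) hR₀0 one_pos hu0 hl0
      fun r hr => by simpa using hle r hr.1
    rw [← h, Real.one_rpow] at this
    linarith
  have hsq : 1 < R₀ ^ 2 := one_lt_pow₀ hR₀lt two_ne_zero
  have hβlt : βb < βl * R₀ ^ 2 := hβ.trans_lt (lt_mul_of_one_lt_right hβl hsq)
  have hlarge : ∀ᶠ r in atTop, lb r < ub (R₀ * r) := by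
    have hR : Tendsto (fun r => R₀ * r) atTop atTop := tendsto_id.const_mul_atTop hR₀0
    filter_upwards [(hui.comp hR).eventually_lt (hli.mul_const (R₀ ^ 2)) hβlt,
      eventually_gt_atTop 0] with r h1 hr
    have h2 : (sp - ub (R₀ * r)) * (R₀ * r) ^ 2 < (sp - lb r) * (R₀ * r) ^ 2 := by
      simp only [Function.comp_apply] at h1
      rw [mul_pow] at h1 ⊢
      linarith
    have := lt_of_mul_lt_mul_right h2 (by positivity)
    linarith
  obtain ⟨C, hC, hCF⟩ := hFd.exists_sub_le_mul_sub 0 sp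
  have hw : ∀ x, 0 < x → SupersolutionAt p q (fun y => ub (R₀ * y) + -lb y)
      (C * (ub (R₀ * x) + -lb x)) x := by
    intro x hx
    have hRx : 0 < R₀ * x := by positivity
    refine (((hsuper.supersolutionAt hRx).comp_mul_left hR₀0).add
      (hsub.supersolutionAt_neg hx)).mono ?_
    have h1 := hCF _ (hlbnd x hx) _ (hubnd _ hRx) (hle x hx)
    have h2 := hF0 _ (hubnd _ hRx).1 (hubnd _ hRx).2
    have h3 := mul_nonneg (sub_nonneg.2 hsq.le) (neg_nonneg.2 h2)
    linarith
  have hwc : ContinuousOn (fun y => ub (R₀ * y) + -lb y) (Ioi 0) :=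
    (huc.comp (by fun_prop) fun y hy => mul_pos hR₀0 hy).add hlc.neg
  have hHopf : ∀ r, 0 < r → ∃ ε > 0, ∀ x ∈ Ioc 0 r,
      ε * x ^ gammaPlus p q ≤ ub (R₀ * x) + -lb x := by
    intro r hr
    obtain ⟨b, hb, hrb⟩ := (hlarge.and (eventually_ge_atTop r)).exists
    obtain ⟨ε, hε, h⟩ := exists_mul_rpow_le_of_supersolutionAt hp hq hC (hr.trans_le hrb) hwc
      (fun x hx => by linarith [hle x hx]) hw (by linarith)
    exact ⟨ε, hε, fun x hx => h x ⟨hx.1, hx.2.trans hrb⟩⟩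
  have hlt : ∀ r, 0 < r → lb r < ub (R₀ * r) := by
    intro r hr
    obtain ⟨ε, hε, h⟩ := hHopf r hr
    have h1 := h r ⟨hr, le_rfl⟩
    have h2 : 0 < ε * r ^ gammaPlus p q := by positivity
    linarith
  have hαlt : αl < αb * R₀ ^ gammaPlus p q := by
    obtain ⟨ε, hε, h⟩ := hHopf 1 one_pos
    have := le_mul_rpow_of_le_comp_mul (ε := ε) hR₀0 one_pos hu0 hl0
      fun r hr => by linarith [h r hr]
    linarith
  have hev := (eventually_le_comp_mul hR₀lt huc hlc hu0 hl0 hui hli hαlt hβlt hlt).and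
    (lt_mem_nhds hR₀lt)
  obtain ⟨R, ⟨hR, hR1⟩, hRlt⟩ :=
    ((hev.filter_mono nhdsWithin_le_nhds).and (self_mem_nhdsWithin : Iio R₀ ∈ 𝓝[<] R₀)).exists
  exact (csInf_le hAbdd ⟨hR1.le, hR⟩).not_gt hRlt
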